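/- Let T be the real root of x³ = x² + x + 1 (the tribonacci number, T ≈ 1.83929). Then for every q ∈ [T, 2), U_q + U_q = [0, 2/(q-1)]; i.e., every t ∈ [0, 2/(q-1)] can be written as t = y + z with y, z ∈ U_q. -/

import Mathlib

noncomputable section

/-- `a` is an expansion of `x` in base `q`: all digits `a n` lie in `{0,1}` and
`x = Σ_{n≥1} a_n q^{-n}` (here `a n` is the `(n+1)`-st digit, i.e. indexing is 0-based). -/
def IsExpansion (q x : ℝ) (a : ℕ → ℕ) : Prop :=
  (∀ n, a n ≤ 1) ∧ x = ∑' n : ℕ, (a n : ℝ) / q ^ (n + 1)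

/-- The set of expansions of `x` in base `q`. -/
def expansionsOf (q x : ℝ) : Set (ℕ → ℕ) := {a | IsExpansion q x a}

/-- `U_q`: the set of `x ∈ [0, 1/(q-1)]` having a unique expansion in base `q`. -/
def uniqueExpansionSet (q : ℝ) : Set ℝ :=
  {x | x ∈ Set.Icc 0 (1 / (q - 1)) ∧ ∃! a, IsExpansion q x a}

/-- `B_m` (for finite `m`): bases `q ∈ (G, 2)` for which some `x ∈ I_q` has exactly `m`
expansions in base `q`. -/
def B (m : ℕ) : Set ℝ :=
  {q | q ∈ Set.Ioo ((1 + Real.sqrt 5) / 2) 2 ∧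
    ∃ x ∈ Set.Icc (0:ℝ) (1 / (q - 1)), Cardinal.mk (expansionsOf q x) = m}

/-- `B_{ℵ₀}`: bases `q ∈ (G, 2)` for which some `x ∈ I_q` has exactly countably infinitely
many expansions in base `q`. -/
def Baleph0 : Set ℝ :=
  {q | q ∈ Set.Ioo ((1 + Real.sqrt 5) / 2) 2 ∧
    ∃ x ∈ Set.Icc (0:ℝ) (1 / (q - 1)), Cardinal.mk (expansionsOf q x) = Cardinal.aleph0}

/-- The Thue–Morse sequence: `thueMorse n` is the parity of the number of 1s in the
binary expansion of `n`. -/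
def thueMorse (n : ℕ) : ℕ := ((Nat.digits 2 n).count 1) % 2

/-- A digit `a m` of an expansion of `x` in base `q` is forced if every expansion of `x`
agreeing with `a` before position `m` also agrees at position `m`. -/
def Forced (q x : ℝ) (a : ℕ → ℕ) (m : ℕ) : Prop :=
  ∀ c : ℕ → ℕ, IsExpansion q x c → (∀ i < m, c i = a i) → c m = a m

/-- The value in base `q` of the tail of the digit sequence `a` that starts at index `n`. -/
def tailValue (q : ℝ) (a : ℕ → ℕ) (n : ℕ) : ℝ := ∑' k : ℕ, (a (n + k) : ℝ) / q ^ (k + 1)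

theorem hasSum_inv_pow_succ {q : ℝ} (hq : 1 < q) :
    HasSum (fun k : ℕ => 1 / q ^ (k + 1)) (1 / (q - 1)) := by
  have h0 : 0 < q := by linarith
  have h := (hasSum_geometric_of_lt_one (inv_nonneg.2 h0.le) (inv_lt_one_of_one_lt₀ hq)).mul_left q⁻¹
  have hf : (fun k : ℕ => 1 / q ^ (k + 1)) = fun k => q⁻¹ * q⁻¹ ^ k := by
    ext k
    rw [pow_succ, one_div, mul_inv, inv_pow, mul_comm]
  have hv : 1 / (q - 1) = q⁻¹ * (1 - q⁻¹)⁻¹ := by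
    rw [← mul_inv, mul_sub, mul_inv_cancel₀ h0.ne', mul_one, one_div]
  rwa [hf, hv]

theorem summable_digits {q : ℝ} (hq : 1 < q) {a : ℕ → ℕ} (ha : ∀ n, a n ≤ 1) (n : ℕ) :
    Summable (fun k : ℕ => (a (n + k) : ℝ) / q ^ (k + 1)) := by
  have h0 : 0 < q := by linarith
  refine Summable.of_nonneg_of_le (fun k => by positivity) (fun k => ?_)
    (hasSum_inv_pow_succ hq).summable
  have : (a (n + k) : ℝ) ≤ 1 := by exact_mod_cast ha _
  gcongr

theorem tailValue_nonneg {q : ℝ} (hq : 1 < q) (a : ℕ → ℕ) (n : ℕ) : 0 ≤ tailValue q a n := by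
  have h0 : 0 < q := by linarith
  exact tsum_nonneg fun k => by positivity

theorem tailValue_le {q : ℝ} (hq : 1 < q) {a : ℕ → ℕ} (ha : ∀ n, a n ≤ 1) (n : ℕ) :
    tailValue q a n ≤ 1 / (q - 1) := by
  have h0 : 0 < q := by linarith
  refine hasSum_le (fun k => ?_) (summable_digits hq ha n).hasSum (hasSum_inv_pow_succ hq)
  have : (a (n + k) : ℝ) ≤ 1 := by exact_mod_cast ha _
  gcongr

theorem mul_tailValue {q : ℝ} (hq : 1 < q) {a : ℕ → ℕ} (ha : ∀ n, a n ≤ 1) (n : ℕ) :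
    q * tailValue q a n = a n + tailValue q a (n + 1) := by
  have h0 : q ≠ 0 := by linarith
  rw [tailValue, (summable_digits hq ha n).tsum_eq_zero_add, mul_add, ← tsum_mul_left, tailValue]
  congr 1
  · simp [mul_div_cancel₀ _ h0]
  · refine tsum_congr fun k => ?_
    rw [show n + (k + 1) = n + 1 + k by ring, pow_succ q (k + 1)]
    field_simp

/-- A digit sequence all of whose tails avoid the switch region is the unique expansion of its
value. -/
theorem tailValue_mem_uniqueExpansionSet {q : ℝ} (hq : 1 < q) {a : ℕ → ℕ} (ha : ∀ n, a n ≤ 1)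
    (h0 : ∀ n, a n = 0 → tailValue q a (n + 1) < 1)
    (h1 : ∀ n, a n = 1 → 1 / (q - 1) - 1 < tailValue q a (n + 1)) :
    tailValue q a 0 ∈ uniqueExpansionSet q := by
  refine ⟨⟨tailValue_nonneg hq a 0, tailValue_le hq ha 0⟩, a, ⟨ha, by simp [tailValue]⟩, ?_⟩
  rintro b ⟨hb, hab⟩
  have digit_eq : ∀ n, tailValue q a n = tailValue q b n → a n = b n := by
    intro n hn
    have ea := mul_tailValue hq ha n
    have eb := mul_tailValue hq hb n
    rw [hn] at ea
    have la := tailValue_nonneg hq b (n + 1)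
    have lb := tailValue_le hq hb (n + 1)
    rcases Nat.le_one_iff_eq_zero_or_eq_one.1 (ha n) with h | h <;>
      rcases Nat.le_one_iff_eq_zero_or_eq_one.1 (hb n) with h' | h'
    · rw [h, h']
    · have := h0 n h
      rw [h] at ea
      rw [h'] at eb
      push_cast at ea eb
      linarith
    · have := h1 n h
      rw [h] at ea
      rw [h'] at eb
      push_cast at ea eb
      linarith
    · rw [h, h']
  have tail_eq : ∀ n, tailValue q a n = tailValue q b n := by
    intro n
    induction n with
    | zero => simpa [tailValue] using hab
    | succ n ih =>
      have ea := mul_tailValue hq ha n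
      have eb := mul_tailValue hq hb n
      rw [ih, digit_eq n ih] at ea
      linarith
  exact funext fun n => (digit_eq n (tail_eq n)).symm

theorem le_tsum_of_mul_le_add {q D M : ℝ} (hq : 1 < q) {a v : ℕ → ℝ}
    (hs : Summable fun k => a k / q ^ (k + 1)) (hv : ∀ n, v n ≤ M)
    (h : ∀ n, q * v n ≤ D * a n + v (n + 1)) :
    v 0 ≤ D * ∑' k, a k / q ^ (k + 1) := by
  have h0 : 0 < q := by linarith
  have key : ∀ n, v 0 ≤ D * ∑ k ∈ Finset.range n, a k / q ^ (k + 1) + v n / q ^ n := by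
    intro n
    induction n with
    | zero => simp
    | succ n ih =>
      refine ih.trans ?_
      rw [Finset.sum_range_succ, mul_add, add_assoc]
      gcongr
      have : v n / q ^ n = q * v n / q ^ (n + 1) := by
        rw [pow_succ]
        field_simp
      rw [this, ← mul_div_assoc, ← add_div]
      gcongr
      exact h n
  have lim : Filter.Tendsto
      (fun n => D * ∑ k ∈ Finset.range n, a k / q ^ (k + 1) + M * (q⁻¹) ^ n) Filter.atTop
      (nhds (D * ∑' k, a k / q ^ (k + 1) + M * 0)) :=
    (hs.hasSum.tendsto_sum_nat.const_mul D).add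
      ((tendsto_pow_atTop_nhds_zero_of_lt_one (inv_nonneg.2 h0.le)
        (inv_lt_one_of_one_lt₀ hq)).const_mul M)
  rw [mul_zero, add_zero] at lim
  refine ge_of_tendsto' lim fun n => (key n).trans ?_
  rw [inv_pow, ← div_eq_mul_inv]
  gcongr
  exact hv n

theorem tsum_le_of_add_le_mul {q D M : ℝ} (hq : 1 < q) {a v : ℕ → ℝ}
    (hs : Summable fun k => a k / q ^ (k + 1)) (hv : ∀ n, M ≤ v n)
    (h : ∀ n, D * a n + v (n + 1) ≤ q * v n) :
    D * ∑' k, a k / q ^ (k + 1) ≤ v 0 := by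
  have := le_tsum_of_mul_le_add (D := -D) (v := fun n => - v n) hq hs
    (fun n => neg_le_neg (hv n)) (fun n => by linarith [h n])
  linarith

/-- An automaton producing digit sequences in base `q`. From every state `s` one may emit
`digit s b` and move to `child s b`, for `b = false` (the lower child) or `b = true` (the upper
child). The values, multiplied by `D`, of the sequences produced from `s` have convex hull
`[lo s, hi s]`; `g` bounds both the gaps between siblings and, from below, the hull lengths. -/
structure DigitAutomaton (S : Type) (q D g κ : ℝ) where
  lo : S → ℝ
  hi : S → ℝ
  child : S → Bool → S
  digit : S → Bool → ℕ
  one_lt : 1 < q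
  pos : 0 < D
  hull : κ * (q - 1) = D
  digit_le : ∀ s b, digit s b ≤ 1
  lo_nonneg : ∀ s, 0 ≤ lo s
  hi_le : ∀ s, hi s ≤ κ
  lo_eq : ∀ s, q * lo s = digit s false * D + lo (child s false)
  hi_eq : ∀ s, q * hi s = digit s true * D + hi (child s true)
  lo_le : ∀ s, q * lo s ≤ digit s true * D + lo (child s true)
  le_hi : ∀ s, digit s false * D + hi (child s false) ≤ q * hi s
  gap_le : ∀ s, digit s true * D + lo (child s true) -
    (digit s false * D + hi (child s false)) ≤ g
  gap_nonneg : 0 ≤ g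
  le_length : ∀ s, g ≤ hi s - lo s
  hi_lt : ∀ s b, digit s b = 0 → hi (child s b) < D
  lt_lo : ∀ s b, digit s b = 1 → κ - D < lo (child s b)

namespace DigitAutomaton

variable {S : Type} {q D g κ : ℝ} (A : DigitAutomaton S q D g κ)

theorem exists_child {s : S} {x u v : ℝ} (huv : g ≤ v - u) (hl : q * A.lo s + u ≤ x)
    (hr : x ≤ q * A.hi s + v) :
    ∃ b, A.digit s b * D + A.lo (A.child s b) + u ≤ x ∧
      x ≤ A.digit s b * D + A.hi (A.child s b) + v := by
  by_cases h : x ≤ A.digit s false * D + A.hi (A.child s false) + v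
  · exact ⟨false, by linarith [A.lo_eq s], h⟩
  · exact ⟨true, by linarith [A.gap_le s], by linarith [A.hi_eq s]⟩

theorem exists_children {s r : S} {x : ℝ} (hl : A.lo s + A.lo r ≤ x)
    (hr : x ≤ A.hi s + A.hi r) :
    ∃ b c, A.lo (A.child s b) + A.lo (A.child r c) ≤ q * x - A.digit s b * D - A.digit r c * D ∧
      q * x - A.digit s b * D - A.digit r c * D ≤ A.hi (A.child s b) + A.hi (A.child r c) := by
  have hq := A.one_lt
  have hg := A.gap_nonneg
  have h1 := A.le_length r
  obtain ⟨b, hb, hb'⟩ := A.exists_child (s := s) (x := q * x) (u := q * A.lo r)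
    (v := q * A.hi r) (by nlinarith) (by nlinarith) (by nlinarith)
  obtain ⟨c, hc, hc'⟩ := A.exists_child (s := r) (x := q * x)
    (u := A.digit s b * D + A.lo (A.child s b)) (v := A.digit s b * D + A.hi (A.child s b))
    (by linarith [A.le_length (A.child s b)]) (by linarith) (by linarith)
  exact ⟨b, c, by linarith, by linarith⟩

theorem tailValue_mem {s : ℕ → S} {b : ℕ → Bool} (hs : ∀ n, s (n + 1) = A.child (s n) (b n)) :
    tailValue q (fun n => A.digit (s n) (b n)) 0 ∈ uniqueExpansionSet q := by
  have hq := A.one_lt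
  have hD := A.pos
  have ha : ∀ n, A.digit (s n) (b n) ≤ 1 := fun n => A.digit_le _ _
  have hK : κ = D * (1 / (q - 1)) := by
    have : q - 1 ≠ 0 := by linarith
    rw [← A.hull]
    field_simp
  have lower : ∀ n, A.lo (s n) ≤ D * tailValue q (fun n => A.digit (s n) (b n)) n := fun n =>
    le_tsum_of_mul_le_add (M := κ) (v := fun k => A.lo (s (n + k))) hq (summable_digits hq ha n)
      (fun k => by linarith [A.le_length (s (n + k)), A.gap_nonneg, A.hi_le (s (n + k))])
      (fun k => by
        rw [← add_assoc, hs, mul_comm D]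
        beta_reduce
        cases b (n + k)
        · exact (A.lo_eq _).le
        · exact A.lo_le _)
  have upper : ∀ n, D * tailValue q (fun n => A.digit (s n) (b n)) n ≤ A.hi (s n) := fun n =>
    tsum_le_of_add_le_mul (M := 0) (v := fun k => A.hi (s (n + k))) hq (summable_digits hq ha n)
      (fun k => by linarith [A.le_length (s (n + k)), A.gap_nonneg, A.lo_nonneg (s (n + k))])
      (fun k => by
        rw [← add_assoc, hs, mul_comm D]
        beta_reduce
        cases b (n + k)
        · exact A.le_hi _
        · exact (A.hi_eq _).ge)
  refine tailValue_mem_uniqueExpansionSet hq ha (fun n h => ?_) (fun n h => ?_)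
  · have h1 := A.hi_lt _ _ h
    have h2 := upper (n + 1)
    rw [hs n] at h2
    nlinarith
  · have h1 := A.lt_lo _ _ h
    have h2 := lower (n + 1)
    rw [hs n] at h2
    nlinarith

theorem exists_add {s : S} {t : ℝ} (hl : A.lo s + A.lo s ≤ D * t)
    (hr : D * t ≤ A.hi s + A.hi s) :
    ∃ y ∈ uniqueExpansionSet q, ∃ z ∈ uniqueExpansionSet q, y + z = t := by
  have hq := A.one_lt
  have hD := A.pos
  let X := {p : S × S × ℝ // A.lo p.1 + A.lo p.2.1 ≤ p.2.2 ∧ p.2.2 ≤ A.hi p.1 + A.hi p.2.1}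
  choose f f' hf hf' using fun p : X => A.exists_children p.2.1 p.2.2
  let next : X → X := fun p => ⟨(A.child p.1.1 (f p), A.child p.1.2.1 (f' p),
    q * p.1.2.2 - A.digit p.1.1 (f p) * D - A.digit p.1.2.1 (f' p) * D), hf p, hf' p⟩
  let p : ℕ → X := fun n => Nat.rec ⟨(s, s, D * t), hl, hr⟩ (fun _ => next) n
  have hp : ∀ n, p (n + 1) = next (p n) := fun n => rfl
  let a : ℕ → ℕ := fun n => A.digit (p n).1.1 (f (p n))
  let b : ℕ → ℕ := fun n => A.digit (p n).1.2.1 (f' (p n))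
  have ha : ∀ n, a n ≤ 1 := fun n => A.digit_le _ _
  have hb : ∀ n, b n ≤ 1 := fun n => A.digit_le _ _
  refine ⟨tailValue q a 0, A.tailValue_mem (s := fun n => (p n).1.1) (b := fun n => f (p n))
    (fun n => rfl), tailValue q b 0, A.tailValue_mem (s := fun n => (p n).1.2.1)
    (b := fun n => f' (p n)) (fun n => rfl), ?_⟩
  have sa := summable_digits hq ha 0
  have sb := summable_digits hq hb 0
  have sab : Summable fun k => ((a (0 + k) : ℝ) + b (0 + k)) / q ^ (k + 1) := by
    simpa only [add_div] using sa.add sb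
  have e : tailValue q a 0 + tailValue q b 0 =
      ∑' k, ((a (0 + k) : ℝ) + b (0 + k)) / q ^ (k + 1) := by
    simp only [add_div]
    exact (sa.tsum_add sb).symm
  have rec_eq : ∀ n, q * (p n).1.2.2 = D * ((a (0 + n) : ℝ) + b (0 + n)) + (p (n + 1)).1.2.2 := by
    intro n
    have h : (p (n + 1)).1.2.2 = q * (p n).1.2.2 - a n * D - b n * D := rfl
    rw [h, zero_add]
    ring
  have h1 := le_tsum_of_mul_le_add (M := κ + κ) (v := fun n => (p n).1.2.2) hq sab
    (fun n => by linarith [(p n).2.2, A.hi_le (p n).1.1, A.hi_le (p n).1.2.1])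
    (fun n => (rec_eq n).le)
  have h2 := tsum_le_of_add_le_mul (M := 0) (v := fun n => (p n).1.2.2) hq sab
    (fun n => by linarith [(p n).2.1, A.lo_nonneg (p n).1.1, A.lo_nonneg (p n).1.2.1])
    (fun n => (rec_eq n).ge)
  rw [e]
  have h3 : (p 0).1.2.2 = D * t := rfl
  exact mul_left_cancel₀ hD.ne' ((h2.trans h3.le).antisymm (h3.ge.trans h1))

/-- Reflection-symmetric automata: a state is a last digit `d` together with a state `c` of a
smaller automaton, whose data describe the situation `d = 0`; for `d = 1` all digits are
reflected. -/
def ofReflection {C : Type} (L H : C → ℝ) (next : C → Bool → Bool × C)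
    (hq : 1 < q) (hD : 0 < D) (hκ : κ * (q - 1) = D) (hg : 0 ≤ g)
    (hL : ∀ c, 0 ≤ L c) (hH : ∀ c, H c ≤ κ) (hHD : ∀ c b, H (next c b).2 < D)
    (hgH : ∀ c, g ≤ H c - L c)
    (lo_eq : ∀ c, q * L c = cond (next c false).1 (q * κ - H (next c false).2)
      (L (next c false).2))
    (hi_eq : ∀ c, q * H c = cond (next c true).1 (q * κ - L (next c true).2)
      (H (next c true).2))
    (lo_le : ∀ c, q * L c ≤ cond (next c true).1 (q * κ - H (next c true).2)
      (L (next c true).2))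
    (le_hi : ∀ c, cond (next c false).1 (q * κ - L (next c false).2)
      (H (next c false).2) ≤ q * H c)
    (gap_le : ∀ c, cond (next c true).1 (q * κ - H (next c true).2) (L (next c true).2) -
      cond (next c false).1 (q * κ - L (next c false).2) (H (next c false).2) ≤ g) :
    DigitAutomaton (Bool × C) q D g κ where
  lo s := cond s.1 (κ - H s.2) (L s.2)
  hi s := cond s.1 (κ - L s.2) (H s.2)
  child s b := (s.1 ^^ (next s.2 (s.1 ^^ b)).1, (next s.2 (s.1 ^^ b)).2)
  digit s b := (s.1 ^^ (next s.2 (s.1 ^^ b)).1).toNat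
  one_lt := hq
  pos := hD
  hull := hκ
  digit_le s b := Bool.toNat_le _
  lo_nonneg := by
    rintro ⟨_ | _, c⟩
    · exact hL c
    · exact sub_nonneg.2 (hH c)
  hi_le := by
    rintro ⟨_ | _, c⟩
    · exact hH c
    · exact sub_le_self _ (hL c)
  lo_eq := by
    rintro ⟨_ | _, c⟩
    · have := lo_eq c
      rcases h : next c false with ⟨_ | _, c'⟩ <;> simp [h] at this ⊢ <;> linarith
    · have := hi_eq c
      rcases h : next c true with ⟨_ | _, c'⟩ <;> simp [h] at this ⊢ <;> linarith
  hi_eq := by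
    rintro ⟨_ | _, c⟩
    · have := hi_eq c
      rcases h : next c true with ⟨_ | _, c'⟩ <;> simp [h] at this ⊢ <;> linarith
    · have := lo_eq c
      rcases h : next c false with ⟨_ | _, c'⟩ <;> simp [h] at this ⊢ <;> linarith
  lo_le := by
    rintro ⟨_ | _, c⟩
    · have := lo_le c
      rcases h : next c true with ⟨_ | _, c'⟩ <;> simp [h] at this ⊢ <;> linarith
    · have := le_hi c
      rcases h : next c false with ⟨_ | _, c'⟩ <;> simp [h] at this ⊢ <;> linarith
  le_hi := by
    rintro ⟨_ | _, c⟩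
    · have := le_hi c
      rcases h : next c false with ⟨_ | _, c'⟩ <;> simp [h] at this ⊢ <;> linarith
    · have := lo_le c
      rcases h : next c true with ⟨_ | _, c'⟩ <;> simp [h] at this ⊢ <;> linarith
  gap_le := by
    rintro ⟨_ | _, c⟩ <;> have := gap_le c <;>
      rcases h : next c true with ⟨_ | _, c'⟩ <;>
      rcases h' : next c false with ⟨_ | _, c''⟩ <;> simp [h, h'] at this ⊢ <;> linarith
  gap_nonneg := hg
  le_length := by
    rintro ⟨_ | _, c⟩
    · exact hgH c
    · have := hgH c
      simp only [cond_true]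
      linarith
  hi_lt := by
    rintro ⟨d, c⟩ b h
    have h' := Bool.toNat_eq_zero.1 h
    simp only [h', cond_false]
    exact hHD _ _
  lt_lo := by
    rintro ⟨d, c⟩ b h
    have h' := Bool.toNat_eq_one.1 h
    simp only [h', cond_true]
    exact sub_lt_sub_left (hHD _ _) _

end DigitAutomaton

/-- States of the automaton producing the sequences in which, after the initial run, all runs have
length at most two: nothing read, inside the initial run, after the first or the second digit of a
later run. -/
inductive RunState
  | start | initial | first | second

/-- States of the automaton producing the sequences in which, after the initial run, all runs
have length at most two and, from there on, the word `1, 2, 1, 2` of run lengths does not occur. `firstᵢ` is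
reached after the first digit of a run, when the lengths of the preceding runs match `i` letters of
the forbidden word; `secondᵢ` is reached after the second digit of a run when completing this run
leads to a match of `i` letters. -/
inductive PrunedRunState
  | start | initial | first₀ | first₁ | first₂ | first₃ | second₀ | second₂

/-- Whether the lower or upper admissible digit changes the last digit, and the next state. -/
def RunState.next : RunState → Bool → Bool × RunState
  | start, b => (b, initial)
  | initial, false => (false, initial)
  | initial, true => (true, first)
  | first, false => (false, second)
  | first, true => (true, first)
  | second, _ => (true, first)

/-- The least value of a sequence produced after the last digit `0`, times `q ^ 3 - 1`. -/
def RunState.lo (q : ℝ) : RunState → ℝ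
  | start => 0
  | initial => 0
  | first => q
  | second => q ^ 2

/-- The greatest value of a sequence produced after the last digit `0`, times `q ^ 3 - 1`. -/
def RunState.hi (q : ℝ) : RunState → ℝ
  | start => q ^ 2 + q + 1
  | _ => q ^ 2 + q

/-- Whether the lower or upper admissible digit changes the last digit, and the next state. -/
def PrunedRunState.next : PrunedRunState → Bool → Bool × PrunedRunState
  | start, b => (b, initial)
  | initial, false => (false, initial)
  | initial, true => (true, first₀)
  | first₀, false => (false, second₀)
  | first₀, true => (true, first₁)
  | first₁, false => (false, second₂)
  | first₁, true => (true, first₁)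
  | first₂, false => (false, second₀)
  | first₂, true => (true, first₃)
  | first₃, _ => (true, first₁)
  | second₀, _ => (true, first₀)
  | second₂, _ => (true, first₂)

/-- The least value of a sequence produced after the last digit `0`, times `q ^ 5 - 1`. -/
def PrunedRunState.lo (q : ℝ) : PrunedRunState → ℝ
  | start => 0
  | initial => 0
  | first₀ => q ^ 3 + 1
  | first₁ => q ^ 3 + q
  | first₂ => q ^ 3 + 1
  | first₃ => q ^ 4 + q
  | second₀ => q ^ 4 + q
  | second₂ => q ^ 4 + q ^ 2

/-- The greatest value of a sequence produced after the last digit `0`, times `q ^ 5 - 1`. -/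
def PrunedRunState.hi (q : ℝ) : PrunedRunState → ℝ
  | start => q ^ 4 + q ^ 3 + q ^ 2 + q + 1
  | initial => q ^ 4 + q ^ 3 + q + 1 - 1 / q
  | first₀ => q ^ 4 + q ^ 3 + q
  | first₁ => q ^ 4 + q ^ 3 + q
  | first₂ => q ^ 4 + q ^ 2 + q
  | first₃ => q ^ 4 + q ^ 3 + q
  | second₀ => q ^ 4 + q ^ 3 + q + 1 - 1 / q
  | second₂ => q ^ 4 + q ^ 3 + q + 1 - 1 / q

theorem exists_add_of_tribonacci_lt {q t : ℝ} (hq : 1 < q) (hq2 : q < 2)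
    (hT : q ^ 2 + q + 1 < q ^ 3) (ht : 0 ≤ t) (ht' : t ≤ 2 / (q - 1)) :
    ∃ y ∈ uniqueExpansionSet q, ∃ z ∈ uniqueExpansionSet q, y + z = t := by
  have hD : 0 < q ^ 3 - 1 := by nlinarith
  have hgap : q ^ 3 - q ^ 2 - q ≤ q := by nlinarith
  have hq' : q ≤ q ^ 2 := by nlinarith
  let A : DigitAutomaton (Bool × RunState) q (q ^ 3 - 1) q (q ^ 2 + q + 1) :=
    DigitAutomaton.ofReflection (RunState.lo q) (RunState.hi q) RunState.next hq hD
      (by ring) (by linarith)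
      (by rintro (_ | _ | _ | _) <;> simp only [RunState.lo] <;> nlinarith)
      (by rintro (_ | _ | _ | _) <;> simp only [RunState.hi] <;> nlinarith)
      (by rintro (_ | _ | _ | _) (_ | _) <;> simp only [RunState.hi, RunState.next] <;> nlinarith)
      (by rintro (_ | _ | _ | _) <;> simp only [RunState.lo, RunState.hi] <;> nlinarith)
      (by rintro (_ | _ | _ | _) <;>
            simp only [RunState.lo, RunState.hi, RunState.next, cond_true, cond_false] <;> ring)
      (by rintro (_ | _ | _ | _) <;>
            simp only [RunState.lo, RunState.hi, RunState.next, cond_true] <;> ring)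
      (by rintro (_ | _ | _ | _) <;>
            simp only [RunState.lo, RunState.hi, RunState.next, cond_true] <;> nlinarith)
      (by rintro (_ | _ | _ | _) <;>
            simp only [RunState.lo, RunState.hi, RunState.next, cond_true, cond_false] <;> nlinarith)
      (by rintro (_ | _ | _ | _) <;>
            simp only [RunState.lo, RunState.hi, RunState.next, cond_true, cond_false] <;> nlinarith)
  refine A.exists_add (s := (false, RunState.start)) (t := t) ?_ ?_
  · change (0 : ℝ) + 0 ≤ _
    rw [add_zero]
    positivity
  · change _ ≤ (q ^ 2 + q + 1) + (q ^ 2 + q + 1)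
    rw [le_div_iff₀ (by linarith)] at ht'
    nlinarith [mul_le_mul_of_nonneg_right ht' (by positivity : 0 ≤ q ^ 2 + q + 1)]

theorem exists_add_of_eq_tribonacci {q t : ℝ} (hq : 1 < q) (hq2 : q < 2)
    (hT : q ^ 3 = q ^ 2 + q + 1) (ht : 0 ≤ t) (ht' : t ≤ 2 / (q - 1)) :
    ∃ y ∈ uniqueExpansionSet q, ∃ z ∈ uniqueExpansionSet q, y + z = t := by
  have h4 : q ^ 4 = 2 * q ^ 2 + 2 * q + 1 := by linear_combination (q + 1) * hT
  have h5 : q ^ 5 = 4 * q ^ 2 + 3 * q + 2 := by linear_combination (q ^ 2 + q + 2) * hT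
  have hinv : 1 / q = q ^ 2 - q - 1 := by
    rw [div_eq_iff (by linarith)]
    linear_combination -hT
  have hl : 1.839 < q := by
    by_contra! h
    nlinarith [mul_nonneg (sub_nonneg.2 hq.le) (sub_nonneg.2 h), sq_nonneg (q - 1)]
  have hu : q < 1.8393 := by
    by_contra! h
    nlinarith [mul_nonneg (sub_nonneg.2 hq2.le) (sub_nonneg.2 h), sq_nonneg (q - 1)]
  have hsl : 1.839 * q < q ^ 2 := by nlinarith
  have hsu : q ^ 2 < 1.8393 * q := by nlinarith
  let A : DigitAutomaton (Bool × PrunedRunState) q (q ^ 5 - 1) 5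
      (q ^ 4 + q ^ 3 + q ^ 2 + q + 1) :=
    DigitAutomaton.ofReflection (PrunedRunState.lo q) (PrunedRunState.hi q) PrunedRunState.next hq
      (by linarith) (by ring) (by norm_num)
      (by rintro (_ | _ | _ | _ | _ | _ | _ | _) <;> simp only [PrunedRunState.lo] <;> linarith)
      (by rintro (_ | _ | _ | _ | _ | _ | _ | _) <;> simp only [PrunedRunState.hi] <;> linarith)
      (by rintro (_ | _ | _ | _ | _ | _ | _ | _) (_ | _) <;>
            simp only [PrunedRunState.hi, PrunedRunState.next] <;> linarith)
      (by rintro (_ | _ | _ | _ | _ | _ | _ | _) <;> simp only [PrunedRunState.lo, PrunedRunState.hi] <;> linarith)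
      (by rintro (_ | _ | _ | _ | _ | _ | _ | _) <;>
            simp only [PrunedRunState.lo, PrunedRunState.hi, PrunedRunState.next, cond_true,
              cond_false, hinv] <;> ring_nf)
      (by rintro (_ | _ | _ | _ | _ | _ | _ | _) <;>
            simp only [PrunedRunState.lo, PrunedRunState.hi, PrunedRunState.next, cond_true,
              hinv] <;> ring_nf <;> linarith)
      (by rintro (_ | _ | _ | _ | _ | _ | _ | _) <;>
            simp only [PrunedRunState.lo, PrunedRunState.hi, PrunedRunState.next, cond_true,
              hinv] <;> ring_nf <;> linarith)
      (by rintro (_ | _ | _ | _ | _ | _ | _ | _) <;>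
            simp only [PrunedRunState.lo, PrunedRunState.hi, PrunedRunState.next, cond_true,
              cond_false, hinv] <;> ring_nf <;> linarith)
      (by rintro (_ | _ | _ | _ | _ | _ | _ | _) <;>
            simp only [PrunedRunState.lo, PrunedRunState.hi, PrunedRunState.next, cond_true,
              cond_false, hinv] <;> ring_nf <;> linarith)
  refine A.exists_add (s := (false, PrunedRunState.start)) (t := t) ?_ ?_
  · change (0 : ℝ) + 0 ≤ _
    rw [add_zero]
    exact mul_nonneg (by linarith) ht
  · change _ ≤ (q ^ 4 + q ^ 3 + q ^ 2 + q + 1) + (q ^ 4 + q ^ 3 + q ^ 2 + q + 1)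
    rw [le_div_iff₀ (by linarith)] at ht'
    nlinarith [mul_le_mul_of_nonneg_right ht' (by positivity : 0 ≤ q ^ 4 + q ^ 3 + q ^ 2 + q + 1)]

theorem stmt16 (T : ℝ) (hT : T ∈ Set.Ioo (1:ℝ) 2)
    (hTeq : T ^ 3 = T ^ 2 + T + 1) :
    ∀ q : ℝ, q ∈ Set.Ico T 2 →
      Set.image2 (· + ·) (uniqueExpansionSet q) (uniqueExpansionSet q) =
        Set.Icc 0 (2 / (q - 1)) := by
  rintro q ⟨hTq, hq2⟩
  have hq : 1 < q := hT.1.trans_le hTq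
  ext t
  constructor
  · rintro ⟨y, hy, z, hz, rfl⟩
    have h : 2 / (q - 1) = 1 / (q - 1) + 1 / (q - 1) := by ring
    exact ⟨add_nonneg hy.1.1 hz.1.1, h ▸ add_le_add hy.1.2 hz.1.2⟩
  · rintro ⟨ht, ht'⟩
    rw [Set.mem_image2]
    rcases hTq.eq_or_lt with rfl | hlt
    · exact exists_add_of_eq_tribonacci hq hq2 hTeq ht ht'
    · refine exists_add_of_tribonacci_lt hq hq2 ?_ ht ht'
      have h1 := hT.1
      have h2 : 0 < q ^ 2 + q * T + T ^ 2 - q - T - 1 := by nlinarith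
      nlinarith [mul_pos (sub_pos.2 hlt) h2]
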